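/- Existence of a valid threshold: assume N > L and 0 < s[1] ≤ s[2] ≤ ⋯ ≤ s[N]. Then there exists an integer k with N−L+1 ≤ k ≤ N such that ĉ_k ≤ 1/s[k] and, when k < N, also 1/s[k+1] < ĉ_k, where ĉ_k = (k+L−N)/Σ_{n=1}^k s[n]. -/

import Mathlib

open Finset

/-- Existence of a valid threshold: assume `N > L` and
`0 < s[1] ≤ ⋯ ≤ s[N]`. Then there exists an integer `k` with
`N−L+1 ≤ k ≤ N` such that `ĉ_k ≤ 1/s[k]` and, when `k < N`, also
`1/s[k+1] < ĉ_k`, where `ĉ_k = (k+L−N)/Σ_{n=1}^k s[n]`. -/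
theorem stmt_10 (N L : ℕ) (hL : 1 ≤ L) (hLN : L < N) (s : ℕ → ℝ)
    (hs : ∀ n ∈ Icc 1 N, 0 < s n)
    (hmono : ∀ m ∈ Icc 1 N, ∀ n ∈ Icc 1 N, m ≤ n → s m ≤ s n) :
    ∃ k : ℕ, N - L + 1 ≤ k ∧ k ≤ N ∧
      ((k : ℝ) + L - N) / (∑ n ∈ Icc 1 k, s n) ≤ 1 / s k ∧
      (k < N → 1 / s (k + 1) < ((k : ℝ) + L - N) / (∑ n ∈ Icc 1 k, s n)) := by
  have hpos : ∀ k, 1 ≤ k → k ≤ N → 0 < ∑ n ∈ Icc 1 k, s n := fun k h1 hk =>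
    sum_pos (fun n hn => hs n (mem_Icc.2 ⟨(mem_Icc.1 hn).1, (mem_Icc.1 hn).2.trans hk⟩))
      ⟨1, mem_Icc.2 ⟨le_rfl, h1⟩⟩
  by_contra! hcon
  have key : ∀ k, N - L + 1 ≤ k → k ≤ N →
      ((k : ℝ) + L - N) / (∑ n ∈ Icc 1 k, s n) ≤ 1 / s k := by
    intro k hk
    induction k, hk using Nat.le_induction with
    | base =>
      intro hkN
      have hsk := hs (N - L + 1) (mem_Icc.2 ⟨by omega, hkN⟩)
      have hcoef : ((N - L + 1 : ℕ) : ℝ) + L - N = 1 := by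
        push_cast [Nat.cast_sub hLN.le]
        ring
      rw [hcoef]
      refine one_div_le_one_div_of_le hsk (single_le_sum (f := s) (fun n hn => ?_) ?_)
      · exact (hs n (mem_Icc.2 ⟨(mem_Icc.1 hn).1, (mem_Icc.1 hn).2.trans hkN⟩)).le
      · exact mem_Icc.2 ⟨by omega, le_rfl⟩
    | succ k hk ih =>
      intro hkN
      have h := (hcon k hk (by omega) (ih (by omega))).2
      have hsk := hs (k + 1) (mem_Icc.2 ⟨by omega, hkN⟩)
      rw [div_le_div_iff₀ (hpos k (by omega) (by omega)) hsk] at h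
      rw [div_le_div_iff₀ (hpos (k + 1) (by omega) hkN) hsk,
        sum_Icc_succ_top (by omega)]
      push_cast
      linarith
  exact absurd (hcon N (by omega) le_rfl (key N (by omega) le_rfl)).1 (lt_irrefl N)
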